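/- arXiv:2501.03636 — 2 statements merged into one kernel-verified Lean document; each statement's English description precedes it below -/
import Mathlib

section
/- Let L be the free Lie algebra on generators x, y over a field K of characteristic 0, and let δ be the derivation with δ(x)=0, δ(y)=x. If g ∈ L satisfies [g, x] + [δ(g), y] = 0 and g is not a scalar multiple of x, then g = α·y + β·x for some α, β ∈ K with α ≠ 0. -/
namespace FreeLieAlgebra

open LieModule.Cohomology Module.End

section General

variable {R X : Type*} [CommRing R]

theorem lieSubalgebra_eq_top (S : LieSubalgebra R (FreeLieAlgebra R X))
    (hS : ∀ i, of R i ∈ S) : S = ⊤ := by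
  let F : FreeLieAlgebra R X →ₗ⁅R⁆ S := lift R fun i => ⟨of R i, hS i⟩
  have hF : S.incl.comp F = LieHom.id := by
    ext i
    simp [F]
  rw [eq_top_iff]
  intro a _
  have ha : (F a : FreeLieAlgebra R X) = a := LieHom.congr_fun hF a
  exact ha ▸ (F a).2

theorem induction_on {p : FreeLieAlgebra R X → Prop} (a : FreeLieAlgebra R X)
    (of : ∀ i, p (of R i)) (zero : p 0) (add : ∀ a b, p a → p b → p (a + b))
    (smul : ∀ (r : R) a, p a → p (r • a)) (lie : ∀ a b, p a → p b → p ⁅a, b⁆) : p a := by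
  let S : LieSubalgebra R (FreeLieAlgebra R X) :=
    { carrier := {a | p a}
      zero_mem' := zero
      add_mem' := fun {a b} => add a b
      smul_mem' := smul
      lie_mem' := fun {a b} => lie a b }
  have ha : a ∈ S := lieSubalgebra_eq_top S of ▸ LieSubalgebra.mem_top a
  exact ha

/-- A map prescribed on the generators extends to a primitive of a given 2-cocycle with values in
the adjoint representation. -/
theorem exists_linearMap_of_twoCocycle
    (c : twoCocycle R (FreeLieAlgebra R X) (FreeLieAlgebra R X)) (f : X → FreeLieAlgebra R X) :
    ∃ T : FreeLieAlgebra R X →ₗ[R] FreeLieAlgebra R X, (∀ i, T (of R i) = f i) ∧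
      ∀ a b, T ⁅a, b⁆ = ⁅T a, b⁆ + ⁅a, T b⁆ + c.1 a b := by
  let F : FreeLieAlgebra R X →ₗ⁅R⁆ LieAlgebra.ofTwoCocycle c :=
    lift R fun i => LieAlgebra.ofProd c (of R i, f i)
  have hF (i : X) : (LieAlgebra.ofProd c).symm (F (of R i)) = (of R i, f i) := by simp [F]
  have hfst (a) : ((LieAlgebra.ofProd c).symm (F a)).1 = a := by
    induction a using induction_on with
    | of i => rw [hF]
    | zero => simp
    | add a b ha hb => simp [ha, hb]
    | smul r a ha => simp [ha]
    | lie a b ha hb => simp [LieAlgebra.bracket_ofTwoCocycle, ha, hb]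
  refine ⟨{ toFun := fun a => ((LieAlgebra.ofProd c).symm (F a)).2
            map_add' := by simp
            map_smul' := by simp }, fun i => by simp [hF], fun a b => ?_⟩
  simp only [LinearMap.coe_mk, AddHom.coe_mk, LieHom.map_lie, LieAlgebra.bracket_ofTwoCocycle,
    Equiv.symm_apply_apply, hfst]
  rw [← lie_skew b]
  simp only [twoCochain_val_apply]
  abel

theorem exists_derivation (f : X → FreeLieAlgebra R X) :
    ∃ T : FreeLieAlgebra R X →ₗ[R] FreeLieAlgebra R X, (∀ i, T (of R i) = f i) ∧
      ∀ a b, T ⁅a, b⁆ = ⁅T a, b⁆ + ⁅a, T b⁆ := by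
  obtain ⟨T, hT, hlie⟩ := exists_linearMap_of_twoCocycle 0 f
  exact ⟨T, hT, fun a b => (hlie a b).trans (add_zero _)⟩

theorem exists_linearForm (f : X → R) :
    ∃ ε : FreeLieAlgebra R X →ₗ[R] R, (∀ i, ε (of R i) = f i) ∧
      ∀ a b : FreeLieAlgebra R X, ε ⁅a, b⁆ = 0 := by
  let := LieRing.ofAssociativeRing (A := R)
  let := LieAlgebra.ofAssociativeAlgebra (R := R) (A := R)
  refine ⟨(lift R f : FreeLieAlgebra R X →ₗ⁅R⁆ R), fun i => lift_of_apply f i, fun a b => ?_⟩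
  change lift R f ⁅a, b⁆ = 0
  rw [LieHom.map_lie, LieRing.of_associative_ring_bracket, mul_comm, sub_self]

/-- If `ε` is a linear form vanishing on brackets and `N` a derivation, then the cocycle
`(a, b) ↦ ε a • N b - ε b • N a` has a primitive with prescribed values on generators. -/
theorem exists_twisted_derivation (ε : FreeLieAlgebra R X →ₗ[R] R)
    (hε : ∀ a b : FreeLieAlgebra R X, ε ⁅a, b⁆ = 0)
    (N : FreeLieAlgebra R X →ₗ[R] FreeLieAlgebra R X)
    (hN : ∀ a b, N ⁅a, b⁆ = ⁅N a, b⁆ + ⁅a, N b⁆) (f : X → FreeLieAlgebra R X) :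
    ∃ T : FreeLieAlgebra R X →ₗ[R] FreeLieAlgebra R X, (∀ i, T (of R i) = f i) ∧
      ∀ a b, T ⁅a, b⁆ = ⁅T a, b⁆ + ⁅a, T b⁆ + (ε a • N b - ε b • N a) := by
  let ω : twoCochain R (FreeLieAlgebra R X) (FreeLieAlgebra R X) :=
    ⟨(LinearMap.lsmul R _ ∘ₗ ε).compl₂ N - ((LinearMap.lsmul R _ ∘ₗ ε).compl₂ N).flip,
      fun a => by simp⟩
  have hω (a b) : ω a b = ε a • N b - ε b • N a := by
    rw [← twoCochain_val_apply]
    simp [ω]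
  have hc : ω ∈ twoCocycle R _ _ := by
    rw [mem_twoCocycle_iff]
    ext a b c
    simp only [d₂₃_apply, hω, hε, hN, lie_sub, lie_smul, LinearMap.zero_apply, zero_smul, smul_add]
    rw [← lie_skew (N a) b, ← lie_skew (N a) c, ← lie_skew (N b) c]
    simp only [smul_neg]
    abel
  obtain ⟨T, hT, hlie⟩ := exists_linearMap_of_twoCocycle ⟨ω, hc⟩ f
  exact ⟨T, hT, fun a b => by rw [hlie, ← hω]⟩

theorem mem_maxGenEigenspace_zero_iff (T : Module.End R (FreeLieAlgebra R X))
    (a : FreeLieAlgebra R X) : a ∈ T.maxGenEigenspace 0 ↔ ∃ k : ℕ, (T ^ k) a = 0 := by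
  simp [mem_maxGenEigenspace]

/-- Local nilpotence propagates from generators when the map is a derivation up to a defect on
which it is locally nilpotent. -/
theorem exists_pow_apply_eq_zero (T : Module.End R (FreeLieAlgebra R X))
    (hof : ∀ i, ∃ k : ℕ, (T ^ k) (of R i) = 0)
    (hlie : ∀ a b, a ∈ T.maxGenEigenspace 0 → b ∈ T.maxGenEigenspace 0 →
      T ⁅a, b⁆ - (⁅T a, b⁆ + ⁅a, T b⁆) ∈ T.maxGenEigenspace 0) (a : FreeLieAlgebra R X) :
    ∃ k : ℕ, (T ^ k) a = 0 := by
  have key (n i j : ℕ) (hn : i + j ≤ n) (a b : FreeLieAlgebra R X) (ha : (T ^ i) a = 0)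
      (hb : (T ^ j) b = 0) : ⁅a, b⁆ ∈ T.maxGenEigenspace 0 := by
    induction n generalizing i j a b with
    | zero =>
      obtain rfl : i = 0 := by lia
      simp_all
    | succ n ih =>
      obtain _ | i := i
      · simp_all
      obtain _ | j := j
      · simp_all
      have h₁ := ih i (j + 1) (by lia) (T a) b (by rwa [pow_succ] at ha) hb
      have h₂ := ih (i + 1) j (by lia) a (T b) ha (by rwa [pow_succ] at hb)
      have h₃ := hlie a b ((mem_maxGenEigenspace_zero_iff T a).2 ⟨_, ha⟩)
        ((mem_maxGenEigenspace_zero_iff T b).2 ⟨_, hb⟩)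
      have h₄ := add_mem h₃ (add_mem h₁ h₂)
      rw [sub_add_cancel, mem_maxGenEigenspace_zero_iff] at h₄
      obtain ⟨k, hk⟩ := h₄
      exact (mem_maxGenEigenspace_zero_iff T _).2 ⟨k + 1, by rwa [pow_succ]⟩
  rw [← mem_maxGenEigenspace_zero_iff]
  induction a using induction_on with
  | of i => exact (mem_maxGenEigenspace_zero_iff T _).2 (hof i)
  | zero => exact zero_mem _
  | add a b ha hb => exact add_mem ha hb
  | smul r a ha => exact Submodule.smul_mem _ r ha
  | lie a b ha hb =>
    obtain ⟨i, hi⟩ := (mem_maxGenEigenspace_zero_iff T a).1 ha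
    obtain ⟨j, hj⟩ := (mem_maxGenEigenspace_zero_iff T b).1 hb
    exact key _ i j le_rfl a b hi hj

end General

section Centralizer

variable {K X : Type*} [Field K]

/-- The sum of the eigenspaces of `N` for positive integer eigenvalues. -/
noncomputable def positivePart (N : Module.End K (FreeLieAlgebra K X)) :
    Submodule K (FreeLieAlgebra K X) :=
  ⨆ n : ℕ, N.eigenspace ((n : K) + 1)

theorem apply_mem_positivePart {N T : Module.End K (FreeLieAlgebra K X)}
    (hT : ∀ a, T (N a) = N (T a)) {a : FreeLieAlgebra K X} (ha : a ∈ positivePart N) :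
    T a ∈ positivePart N := by
  have hle : positivePart N ≤ (positivePart N).comap T := by
    refine iSup_le fun n a ha => Submodule.mem_iSup_of_mem n ?_
    rw [mem_eigenspace_iff] at ha ⊢
    rw [← hT, ha, map_smul]
  exact hle ha

theorem eq_zero_of_mem_positivePart [CharZero K] {N : Module.End K (FreeLieAlgebra K X)}
    {a : FreeLieAlgebra K X} (ha : a ∈ positivePart N) (hNa : N a = 0) : a = 0 := by
  have hle : positivePart N ≤ ⨆ (μ : K) (_ : μ ≠ 0), N.eigenspace μ :=
    iSup_le fun n => le_iSup₂_of_le ((n : K) + 1) (Nat.cast_add_one_ne_zero n) le_rfl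
  exact Submodule.disjoint_def.1 (N.eigenspaces_iSupIndep 0) a (by simpa using hNa) (hle ha)

theorem lie_mem_positivePart {N : Module.End K (FreeLieAlgebra K X)}
    (hN : ∀ a b, N ⁅a, b⁆ = ⁅N a, b⁆ + ⁅a, N b⁆) {a b : FreeLieAlgebra K X}
    (ha : a ∈ positivePart N) (hb : b ∈ positivePart N) : ⁅a, b⁆ ∈ positivePart N := by
  induction ha using Submodule.iSup_induction' with
  | zero => simp
  | add a₁ a₂ _ _ h₁ h₂ => rw [add_lie]; exact add_mem h₁ h₂
  | mem m a ha =>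
    induction hb using Submodule.iSup_induction' with
    | zero => simp
    | add b₁ b₂ _ _ h₁ h₂ => rw [lie_add]; exact add_mem h₁ h₂
    | mem n b hb =>
      refine Submodule.mem_iSup_of_mem (m + n + 1) ?_
      rw [mem_eigenspace_iff] at ha hb ⊢
      rw [hN, ha, hb, smul_lie, lie_smul, ← add_smul]
      push_cast
      congr 1
      ring

theorem exists_smul_add_mem_positivePart {N : Module.End K (FreeLieAlgebra K (Fin 2))}
    (hN : ∀ a b, N ⁅a, b⁆ = ⁅N a, b⁆ + ⁅a, N b⁆) (hx : N (of K (0 : Fin 2)) = 0)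
    (hy : N (of K (1 : Fin 2)) = of K (1 : Fin 2)) (a : FreeLieAlgebra K (Fin 2)) :
    ∃ c : K, ∃ b ∈ positivePart N, a = c • of K (0 : Fin 2) + b := by
  have had {b : FreeLieAlgebra K (Fin 2)} (hb : b ∈ positivePart N) :
      ⁅of K (0 : Fin 2), b⁆ ∈ positivePart N :=
    apply_mem_positivePart (T := LieAlgebra.ad K (FreeLieAlgebra K (Fin 2)) (of K (0 : Fin 2)))
      (by simp [hN, hx]) hb
  induction a using induction_on with
  | of i =>
    fin_cases i
    · exact ⟨1, 0, zero_mem _, by simp⟩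
    · exact ⟨0, of K 1, Submodule.mem_iSup_of_mem 0 (by simp [hy]), by simp⟩
  | zero => exact ⟨0, 0, zero_mem _, by simp⟩
  | add a b ha hb =>
    obtain ⟨c, a, ha, rfl⟩ := ha
    obtain ⟨d, b, hb, rfl⟩ := hb
    exact ⟨c + d, a + b, add_mem ha hb, by module⟩
  | smul r a ha =>
    obtain ⟨c, a, ha, rfl⟩ := ha
    exact ⟨r * c, r • a, Submodule.smul_mem _ r ha, by module⟩
  | lie a b ha hb =>
    obtain ⟨c, a, ha, rfl⟩ := ha
    obtain ⟨d, b, hb, rfl⟩ := hb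
    refine ⟨0, c • ⁅of K (0 : Fin 2), b⁆ - d • ⁅of K (0 : Fin 2), a⁆ + ⁅a, b⁆,
      add_mem (sub_mem (Submodule.smul_mem _ c (had hb)) (Submodule.smul_mem _ d (had ha)))
        (lie_mem_positivePart hN ha hb), ?_⟩
    simp only [add_lie, lie_add, smul_lie, lie_smul, lie_self]
    rw [← lie_skew a (of K (0 : Fin 2))]
    module

/-- The centralizer of a free generator `x` is spanned by `x`. -/
theorem exists_eq_smul_of_lie_eq_zero [CharZero K] {u : FreeLieAlgebra K (Fin 2)}
    (hu : ⁅u, of K (0 : Fin 2)⁆ = 0) :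
    ∃ c : K, u = c • of K (0 : Fin 2) := by
  obtain ⟨N, hNof, hN⟩ := exists_derivation (R := K) (X := Fin 2) ![0, of K (1 : Fin 2)]
  obtain ⟨ε, hεof, hε⟩ := exists_linearForm (R := K) (X := Fin 2) ![1, (0 : K)]
  obtain ⟨E, hEof, hE⟩ := exists_twisted_derivation ε hε N hN 0
  have hNx : N (of K (0 : Fin 2)) = 0 := hNof 0
  have hNy : N (of K (1 : Fin 2)) = of K (1 : Fin 2) := hNof 1
  have hεx : ε (of K (0 : Fin 2)) = 1 := hεof 0
  have hεN (a) : ε (N a) = 0 := by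
    induction a using induction_on with
    | of i => fin_cases i <;> simp [hNx, hNy, hεof]
    | zero => simp
    | add a b ha hb => simp [ha, hb]
    | smul r a ha => simp [ha]
    | lie a b _ _ => simp [hN, hε]
  have hcomm (a) : E (N a) = N (E a) := by
    induction a using induction_on with
    | of i => fin_cases i <;> simp [hNx, hNy, hEof]
    | zero => simp
    | add a b ha hb => simp [ha, hb]
    | smul r a ha => simp [ha]
    | lie a b ha hb =>
      simp only [hN, hE, map_add, map_sub, map_smul, hεN, ha, hb, zero_smul]
      abel
  have hpow (k : ℕ) (a) : (E ^ k) (N a) = N ((E ^ k) a) := by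
    induction k with
    | zero => rfl
    | succ k ih => simp only [pow_succ', Module.End.mul_apply, ih, hcomm]
  have hstable {a} (ha : a ∈ maxGenEigenspace E 0) : N a ∈ maxGenEigenspace E 0 := by
    rw [mem_maxGenEigenspace_zero_iff] at ha ⊢
    obtain ⟨k, hk⟩ := ha
    exact ⟨k, by rw [hpow, hk, map_zero]⟩
  have hnil (a) : ∃ k : ℕ, (E ^ k) a = 0 := by
    refine exists_pow_apply_eq_zero E (fun i => ⟨1, by simp [hEof]⟩) (fun a b ha hb => ?_) a
    rw [hE, add_sub_cancel_left]
    exact sub_mem (Submodule.smul_mem _ _ (hstable hb)) (Submodule.smul_mem _ _ (hstable ha))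
  have hEad (a) : E ⁅of K (0 : Fin 2), a⁆ = ⁅of K (0 : Fin 2), E a⁆ + N a := by
    simp [hE, hEof, hNx, hεx]
  have hEpow (k : ℕ) (a) :
      (E ^ (k + 1)) ⁅of K (0 : Fin 2), a⁆ =
        ⁅of K (0 : Fin 2), (E ^ (k + 1)) a⁆ + ((k : K) + 1) • N ((E ^ k) a) := by
    induction k with
    | zero => simp [hEad]
    | succ k ih =>
      rw [pow_succ' E (k + 1), Module.End.mul_apply, ih, map_add, hEad, map_smul, hcomm,
        pow_succ' E k]
      simp only [Module.End.mul_apply]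
      push_cast
      module
  obtain ⟨c, v, hv, rfl⟩ := exists_smul_add_mem_positivePart hN hNx hNy u
  have hxv : ⁅of K (0 : Fin 2), v⁆ = 0 := by
    rw [← lie_skew, neg_eq_zero]
    simpa using hu
  have hzero (k : ℕ) (hk : (E ^ k) v = 0) : v = 0 := by
    induction k with
    | zero => exact hk
    | succ k ih =>
      have h := hEpow k v
      rw [hxv, hk, lie_zero, map_zero, zero_add, eq_comm, smul_eq_zero] at h
      refine ih (eq_zero_of_mem_positivePart ?_ (h.resolve_left (Nat.cast_add_one_ne_zero k)))
      exact apply_mem_positivePart (hpow k) hv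
  obtain ⟨k, hk⟩ := hnil v
  exact ⟨c, by rw [hzero k hk, add_zero]⟩

end Centralizer

end FreeLieAlgebra

theorem constant_like_condition_free_lie {K : Type*} [Field K] [CharZero K]
    (δ : FreeLieAlgebra K (Fin 2) →ₗ[K] FreeLieAlgebra K (Fin 2))
    (hδ : ∀ a b : FreeLieAlgebra K (Fin 2), δ ⁅a, b⁆ = ⁅δ a, b⁆ + ⁅a, δ b⁆)
    (hx : δ (FreeLieAlgebra.of K (0 : Fin 2)) = 0)
    (hy : δ (FreeLieAlgebra.of K (1 : Fin 2)) = FreeLieAlgebra.of K (0 : Fin 2))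
    (g : FreeLieAlgebra K (Fin 2))
    (h : ⁅g, FreeLieAlgebra.of K (0 : Fin 2)⁆ + ⁅δ g, FreeLieAlgebra.of K (1 : Fin 2)⁆ = 0)
    (hg : ¬∃ c : K, g = c • FreeLieAlgebra.of K (0 : Fin 2)) :
    ∃ α β : K, α ≠ 0 ∧
      g = α • FreeLieAlgebra.of K (1 : Fin 2) + β • FreeLieAlgebra.of K (0 : Fin 2) := by
  set x := FreeLieAlgebra.of K (0 : Fin 2) with hxdef
  set y := FreeLieAlgebra.of K (1 : Fin 2) with hydef
  have hnil (a) : ∃ k : ℕ, (δ ^ k) a = 0 := by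
    refine FreeLieAlgebra.exists_pow_apply_eq_zero δ (fun i => ⟨2, ?_⟩) (fun a b _ _ => ?_) a
    · fin_cases i <;> simp [pow_two, ← hxdef, ← hydef, hx, hy]
    · simp [hδ]
  -- Applying `δ` repeatedly to the relation.
  have hrel (k : ℕ) : ((k : K) + 1) • ⁅(δ ^ k) g, x⁆ + ⁅(δ ^ (k + 1)) g, y⁆ = 0 := by
    induction k with
    | zero => simpa using h
    | succ k ih =>
      have := congrArg δ ih
      simp only [map_add, map_smul, map_zero, hδ, hx, hy, lie_zero, add_zero] at this
      simp only [pow_succ' δ, Module.End.mul_apply] at this ⊢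
      rw [← this]
      push_cast
      module
  have hsucc (k : ℕ) : (k : K) + 1 ≠ 0 := Nat.cast_add_one_ne_zero k
  have hcent (k : ℕ) (c : K) (hc : (δ ^ (k + 1)) g = c • x) :
      ∃ β : K, (δ ^ k) g = (c / ((k : K) + 1)) • y + β • x := by
    have hk := hrel k
    have : ⁅(δ ^ k) g - (c / ((k : K) + 1)) • y, x⁆ = 0 := by
      rw [hc, smul_lie, ← lie_skew x y] at hk
      refine (smul_eq_zero.1 ?_).resolve_left (hsucc k)
      rw [sub_lie, smul_lie, smul_sub, smul_smul, mul_div_cancel₀ _ (hsucc k), ← hk]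
      module
    obtain ⟨β, hβ⟩ := FreeLieAlgebra.exists_eq_smul_of_lie_eq_zero this
    exact ⟨β, by rw [← hβ]; abel⟩
  -- The relation forces `δ ^ 2` to kill `g`.
  have hdesc (k : ℕ) (hk : (δ ^ (k + 2)) g = 0) : (δ ^ 2) g = 0 := by
    induction k with
    | zero => exact hk
    | succ k ih =>
      obtain ⟨c, hc⟩ := hcent (k + 2) 0 (by rw [zero_smul]; exact hk)
      rw [zero_div, zero_smul, zero_add] at hc
      obtain ⟨β, hβ⟩ := hcent (k + 1) c hc
      have hc' := congrArg δ hβ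
      rw [← Module.End.mul_apply, ← pow_succ' δ, hc, map_add, map_smul, map_smul, hx, hy,
        smul_zero, add_zero] at hc'
      apply ih
      rw [hc]
      rw [← sub_eq_zero, ← sub_smul, smul_eq_zero] at hc'
      obtain hc' | hc' := hc'
      · have : c = 0 := by
          have hk₂ := hsucc (k + 1)
          field_simp at hc'
          push_cast at hc'
          refine (mul_eq_zero.1 ?_).resolve_right (hsucc k)
          linear_combination hc'
        rw [this, zero_smul]
      · rw [hc', smul_zero]
  obtain ⟨n, hn⟩ := hnil g
  have h₂ : (δ ^ 2) g = 0 := hdesc n (by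
    rw [add_comm, pow_add, Module.End.mul_apply, hn, map_zero])
  obtain ⟨c, hc⟩ := hcent 1 0 (by rw [zero_smul]; exact h₂)
  rw [zero_div, zero_smul, zero_add] at hc
  obtain ⟨β, hβ⟩ := hcent 0 c hc
  rw [pow_zero, Module.End.one_apply, Nat.cast_zero, zero_add, div_one] at hβ
  refine ⟨c, β, ?_, hβ⟩
  rintro rfl
  exact hg ⟨β, by rw [hβ, zero_smul, zero_add]⟩
end

section
/- Let L be the free Lie algebra on x, y over a field of characteristic 0 with δ the derivation given by δ(x)=0, δ(y)=x. Suppose M = [A, B] ≠ 0 with δ(M)=0, and suppose r, s ≥ 2 satisfy δ^r(A)=0=δ^s(B) and δ^{r-1}(A)≠0≠δ^{s-1}(B). Then δ^{r-1}(A) = α·δ^{s-1}(B) for some nonzero scalar α. -/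
namespace FreeLieAlgebra

open MonoidAlgebra

theorem induction {R X : Type*} [CommRing R] {p : FreeLieAlgebra R X → Prop} (zero : p 0)
    (add : ∀ a b, p a → p b → p (a + b)) (smul : ∀ (c : R) a, p a → p (c • a))
    (lie : ∀ a b, p a → p b → p ⁅a, b⁆) (of : ∀ i, p (of R i)) (a : FreeLieAlgebra R X) :
    p a := by
  let S : LieSubalgebra R (FreeLieAlgebra R X) :=
    { carrier := {a | p a}
      zero_mem' := zero
      add_mem' := fun {a b} ha hb => add a b ha hb
      smul_mem' := fun c a ha => smul c a ha
      lie_mem' := fun {a b} ha hb => lie a b ha hb }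
  let F : FreeLieAlgebra R X →ₗ⁅R⁆ S := lift R fun i => ⟨FreeLieAlgebra.of R i, of i⟩
  have h : S.incl.comp F = LieHom.id := by
    ext i
    simp [F]
  have h' : ((F a : S) : FreeLieAlgebra R X) = a := by
    simpa using LieHom.congr_fun h a
  rw [← h']
  exact (F a).2

variable {K X : Type*} [Field K]

/-- The elements of the free associative algebra all of whose words have length in `S`. -/
def lengthSupported (K X : Type*) [Field K] (S : Set ℕ) :
    Submodule K (MonoidAlgebra K (FreeMonoid X)) where
  carrier := {f | ∀ w, w.length ∉ S → f.coeff w = 0}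
  zero_mem' := by simp
  add_mem' := fun {f g} hf hg w hw => by simp [hf w hw, hg w hw]
  smul_mem' := fun c f hf w hw => by simp [hf w hw]

theorem lengthSupported_mono {S T : Set ℕ} (h : S ⊆ T) :
    lengthSupported K X S ≤ lengthSupported K X T :=
  fun _ hf w hw => hf w fun hs => hw (h hs)

theorem eq_zero_of_mem_lengthSupported {S T : Set ℕ} (h : Disjoint S T)
    {f : MonoidAlgebra K (FreeMonoid X)} (hS : f ∈ lengthSupported K X S)
    (hT : f ∈ lengthSupported K X T) : f = 0 := by
  ext w
  by_cases hw : w.length ∈ S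
  · exact hT w (Set.disjoint_left.1 h hw)
  · exact hS w hw

theorem mul_mem_lengthSupported {S T U : Set ℕ} (h : ∀ i ∈ S, ∀ j ∈ T, i + j ∈ U)
    {f g : MonoidAlgebra K (FreeMonoid X)} (hf : f ∈ lengthSupported K X S)
    (hg : g ∈ lengthSupported K X T) : f * g ∈ lengthSupported K X U := by
  classical
  intro w hw
  rw [coeff_mul]
  refine Finset.sum_eq_zero fun u _ => Finset.sum_eq_zero fun v _ => ?_
  dsimp only
  split_ifs with huv
  · by_cases hu : u.length ∈ S
    · by_cases hv : v.length ∈ T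
      · exact absurd (by rw [← huv, FreeMonoid.length_mul]; exact h _ hu _ hv) hw
      · rw [hg v hv, mul_zero]
    · rw [hf u hu, zero_mul]
  · rfl

theorem pow_mem_lengthSupported {n : ℕ} {f : MonoidAlgebra K (FreeMonoid X)}
    (hf : f ∈ lengthSupported K X {n}) (k : ℕ) : f ^ k ∈ lengthSupported K X {k * n} := by
  induction k with
  | zero =>
    classical
    intro w hw
    rw [pow_zero, one_def, coeff_single, Finsupp.single_apply, if_neg]
    rintro rfl
    simp at hw
  | succ k ih =>
    rw [pow_succ]
    refine mul_mem_lengthSupported ?_ ih hf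
    rintro _ rfl _ rfl
    simp [add_mul]

theorem coeff_mul_of_mem_lengthSupported {n : ℕ} {f g : MonoidAlgebra K (FreeMonoid X)}
    (hf : f ∈ lengthSupported K X {n}) {u : FreeMonoid X} (hu : u.length = n)
    (v : FreeMonoid X) : (f * g).coeff (u * v) = f.coeff u * g.coeff v := by
  classical
  have key : ∀ u' v', u'.length = n → (u' * v' = u * v ↔ u' = u ∧ v' = v) := fun u' v' hl =>
    ⟨fun e => List.append_inj e (hl.trans hu.symm), fun ⟨h₁, h₂⟩ => by rw [h₁, h₂]⟩
  rw [coeff_mul, Finsupp.sum, Finset.sum_eq_single u, Finsupp.sum, Finset.sum_eq_single v]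
  · simp
  · intro v' _ hv'
    exact if_neg fun e => hv' ((key u v' hu).1 e).2
  · intro hv
    simp [Finsupp.notMem_support_iff.1 hv]
  · intro u' hu' hne
    refine Finset.sum_eq_zero fun v' _ => if_neg fun e => hne ((key u' v' ?_).1 e).1
    by_contra hl
    exact Finsupp.mem_support_iff.1 hu' (hf u' hl)
  · intro h
    simp [Finsupp.notMem_support_iff.1 h, Finsupp.sum]

theorem exists_coeff_ne_zero {f : MonoidAlgebra K (FreeMonoid X)} (hf : f ≠ 0) :
    ∃ w, f.coeff w ≠ 0 := by
  by_contra! h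
  exact hf (by ext w; exact h w)

theorem exists_smul_eq_of_commute {n : ℕ} {f g : MonoidAlgebra K (FreeMonoid X)}
    (hf : f ∈ lengthSupported K X {n}) (hg : g ∈ lengthSupported K X {n}) (hg0 : g ≠ 0)
    (h : f * g = g * f) : ∃ c : K, f = c • g := by
  obtain ⟨u, hu⟩ := exists_coeff_ne_zero hg0
  have hul : u.length = n := by
    by_contra hl
    exact hu (hg u hl)
  refine ⟨f.coeff u / g.coeff u, ?_⟩
  ext v
  have e := congrArg (fun F => F.coeff (u * v)) h
  simp only [coeff_mul_of_mem_lengthSupported hf hul,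
    coeff_mul_of_mem_lengthSupported hg hul] at e
  rw [coeff_smul, Finsupp.smul_apply, smul_eq_mul]
  field_simp
  linear_combination -e

section Coproduct

variable (K X)

/-- The embedding of the free associative algebra in the first tensor factor. -/
noncomputable def inLeft :
    MonoidAlgebra K (FreeMonoid X) →ₐ[K] MonoidAlgebra K (FreeMonoid X × FreeMonoid X) :=
  mapDomainAlgHom K K (MonoidHom.inl _ _)

/-- The embedding of the free associative algebra in the second tensor factor. -/
noncomputable def inRight :
    MonoidAlgebra K (FreeMonoid X) →ₐ[K] MonoidAlgebra K (FreeMonoid X × FreeMonoid X) :=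
  mapDomainAlgHom K K (MonoidHom.inr _ _)

/-- The coproduct of the free associative algebra for which the letters are primitive. -/
noncomputable def coproduct :
    MonoidAlgebra K (FreeMonoid X) →ₐ[K] MonoidAlgebra K (FreeMonoid X × FreeMonoid X) :=
  MonoidAlgebra.lift K _ _ (FreeMonoid.lift fun i =>
    inLeft K X (single (FreeMonoid.of i) 1) + inRight K X (single (FreeMonoid.of i) 1))

variable {K X}

theorem inLeft_single (u : FreeMonoid X) (c : K) : inLeft K X (single u c) = single (u, 1) c := by
  simp [inLeft]

theorem inRight_single (u : FreeMonoid X) (c : K) :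
    inRight K X (single u c) = single (1, u) c := by
  simp [inRight]

theorem commute_inLeft_inRight (f g : MonoidAlgebra K (FreeMonoid X)) :
    Commute (inLeft K X f) (inRight K X g) := by
  induction f using MonoidAlgebra.induction_linear with
  | zero => simp
  | add f₁ f₂ h₁ h₂ => rw [map_add]; exact h₁.add_left h₂
  | single u c =>
    induction g using MonoidAlgebra.induction_linear with
    | zero => simp
    | add g₁ g₂ h₁ h₂ => rw [map_add]; exact h₁.add_right h₂
    | single v d =>
      rw [inLeft_single, inRight_single]
      exact single_commute_single (by simp [Commute, SemiconjBy]) (Commute.all c d)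

theorem coeff_inLeft_mul_inRight (f g : MonoidAlgebra K (FreeMonoid X)) (u v : FreeMonoid X) :
    (inLeft K X f * inRight K X g).coeff (u, v) = f.coeff u * g.coeff v := by
  classical
  induction f using MonoidAlgebra.induction_linear with
  | zero => simp
  | add f₁ f₂ h₁ h₂ => simp [add_mul, h₁, h₂]
  | single u' c =>
    induction g using MonoidAlgebra.induction_linear with
    | zero => simp
    | add g₁ g₂ h₁ h₂ => simp only [map_add, mul_add, coeff_add, Finsupp.add_apply, h₁, h₂]
    | single v' d =>
      rw [inLeft_single, inRight_single, single_mul_single]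
      simp only [Prod.mk_mul_mk, mul_one, one_mul, coeff_single, Finsupp.single_apply,
        Prod.mk.injEq]
      split_ifs <;> simp_all

theorem coeff_add_pow (f : MonoidAlgebra K (FreeMonoid X)) (k : ℕ) (u v : FreeMonoid X) :
    ((inLeft K X f + inRight K X f) ^ k).coeff (u, v) =
      ∑ j ∈ Finset.range (k + 1), (k.choose j : K) * ((f ^ (k - j)).coeff u * (f ^ j).coeff v) := by
  rw [add_comm, (commute_inLeft_inRight f f).symm.add_pow, coeff_sum, Finsupp.finsetSum_apply]
  refine Finset.sum_congr rfl fun j _ => ?_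
  rw [← map_pow, ← map_pow, (commute_inLeft_inRight _ _).symm.eq, ← nsmul_eq_mul', coeff_smul,
    Finsupp.smul_apply, coeff_inLeft_mul_inRight, nsmul_eq_mul]

/-- If a power of a nonzero primitive homogeneous element `f` of degree `n` is a multiple of a power
of a primitive homogeneous element of degree `m`, then `m ≤ n`: otherwise only the coproduct of
`f ^ k` has a component of degree `n` in the second tensor factor. -/
theorem le_of_pow_eq_smul_pow [CharZero K] {n m k l : ℕ} {f g : MonoidAlgebra K (FreeMonoid X)}
    (hf : f ∈ lengthSupported K X {n}) (hg : g ∈ lengthSupported K X {m}) (hf0 : f ≠ 0)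
    (hn : 0 < n) (hk : 0 < k) (hΔf : coproduct K X f = inLeft K X f + inRight K X f)
    (hΔg : coproduct K X g = inLeft K X g + inRight K X g) {c : K}
    (h : f ^ k = c • g ^ l) : m ≤ n := by
  by_contra! hlt
  obtain ⟨v, hv⟩ := exists_coeff_ne_zero hf0
  obtain ⟨u, hu⟩ := exists_coeff_ne_zero (pow_ne_zero (k - 1) hf0)
  have hvl : v.length = n := by
    by_contra hl
    exact hv (hf v hl)
  have e := congrArg (fun F => (coproduct K X F).coeff (u, v)) h
  simp only [map_pow, map_smul, hΔf, hΔg, coeff_smul, Finsupp.smul_apply, coeff_add_pow] at e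
  rw [Finset.sum_eq_single 1, Finset.sum_eq_zero] at e
  · simp [hk.ne', hu, hv] at e
  · intro j _
    rw [pow_mem_lengthSupported hg j v, mul_zero, mul_zero]
    rw [hvl, Set.mem_singleton_iff]
    rintro rfl
    rcases Nat.eq_zero_or_pos j with rfl | hj
    · simp at hn
    · nlinarith
  · intro j _ hj
    rw [pow_mem_lengthSupported hf j v, mul_zero, mul_zero]
    rw [hvl, Set.mem_singleton_iff]
    intro hjn
    exact hj (Nat.eq_of_mul_eq_mul_right hn (by omega))
  · intro h1
    exact absurd (Finset.mem_range.2 (by omega)) h1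

end Coproduct

section Embedding

attribute [local instance] LieRing.ofAssociativeRing

variable (K X)

/-- The canonical map from the free Lie algebra to the free associative algebra. -/
noncomputable def toWords : FreeLieAlgebra K X →ₗ⁅K⁆ MonoidAlgebra K (FreeMonoid X) :=
  lift K fun i => single (FreeMonoid.of i) 1

/-- The free associative algebra acts on `L × K`, the letter `x` by
`(l, t) ↦ (⁅x, l⁆ + t • x, 0)`. -/
noncomputable def dynkinAction :
    MonoidAlgebra K (FreeMonoid X) →ₐ[K] Module.End K (FreeLieAlgebra K X × K) :=
  MonoidAlgebra.lift K _ _ (FreeMonoid.lift fun i =>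
    (LinearMap.inl K (FreeLieAlgebra K X) K).comp
      (LinearMap.coprod (LieAlgebra.ad K (FreeLieAlgebra K X) (of K i))
        (LinearMap.toSpanSingleton K _ (of K i))))

variable {K X}

theorem toWords_lie (a b : FreeLieAlgebra K X) :
    toWords K X ⁅a, b⁆ = toWords K X a * toWords K X b - toWords K X b * toWords K X a := by
  rw [LieHom.map_lie, Ring.lie_def]

theorem coproduct_toWords (a : FreeLieAlgebra K X) :
    coproduct K X (toWords K X a) =
      inLeft K X (toWords K X a) + inRight K X (toWords K X a) := by
  induction a using induction with
  | zero => simp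
  | add a b ha hb => simp only [map_add, ha, hb]; abel
  | smul c a ha => simp only [map_smul, ha, smul_add]
  | lie a b ha hb =>
    have h₁ := (commute_inLeft_inRight (toWords K X a) (toWords K X b)).eq
    have h₂ := (commute_inLeft_inRight (toWords K X b) (toWords K X a)).eq
    simp only [toWords_lie, map_sub, map_mul, ha, hb, mul_add, add_mul, h₁, h₂]
    abel
  | of i => simp [toWords, coproduct]

/-- A homogeneous element of degree `n`: its words have length `n`, and it acts on `L × K` by
`(l, t) ↦ (⁅a, l⁆ + (t * n) • a, 0)`. -/
structure IsHomogeneousOfDegree (n : ℕ) (a : FreeLieAlgebra K X) : Prop where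
  action : ∀ l t, dynkinAction K X (toWords K X a) (l, t) = (⁅a, l⁆ + (t * n) • a, 0)
  words : toWords K X a ∈ lengthSupported K X {n}

namespace IsHomogeneousOfDegree

variable {n m : ℕ} {a b : FreeLieAlgebra K X}

theorem zero : IsHomogeneousOfDegree n (0 : FreeLieAlgebra K X) :=
  ⟨by simp [Prod.ext_iff], by simp⟩

theorem add (ha : IsHomogeneousOfDegree n a) (hb : IsHomogeneousOfDegree n b) :
    IsHomogeneousOfDegree n (a + b) := by
  refine ⟨fun l t => ?_, by rw [map_add]; exact add_mem ha.words hb.words⟩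
  rw [map_add, map_add, LinearMap.add_apply, ha.action, hb.action, Prod.mk_add_mk, add_lie,
    smul_add, add_zero]
  congr 1
  abel

theorem smul (c : K) (ha : IsHomogeneousOfDegree n a) : IsHomogeneousOfDegree n (c • a) := by
  refine ⟨fun l t => ?_, by rw [map_smul]; exact Submodule.smul_mem _ _ ha.words⟩
  rw [map_smul, map_smul, LinearMap.smul_apply, ha.action, Prod.smul_mk, smul_lie, smul_add,
    smul_zero, smul_comm]

theorem lie (ha : IsHomogeneousOfDegree n a) (hb : IsHomogeneousOfDegree m b) :
    IsHomogeneousOfDegree (n + m) ⁅a, b⁆ := by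
  refine ⟨fun l t => ?_, ?_⟩
  · rw [toWords_lie, map_sub, map_mul, map_mul, LinearMap.sub_apply, Module.End.mul_apply,
      Module.End.mul_apply, ha.action, hb.action, ha.action, hb.action, Prod.mk_sub_mk, sub_zero]
    congr 1
    rw [lie_add, lie_add, lie_smul, lie_smul, lie_lie, ← lie_skew b a, Nat.cast_add]
    module
  · rw [toWords_lie]
    refine sub_mem (mul_mem_lengthSupported ?_ ha.words hb.words)
      (mul_mem_lengthSupported ?_ hb.words ha.words)
    · rintro _ rfl _ rfl
      rfl
    · rintro _ rfl _ rfl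
      exact add_comm _ _

theorem of (i : X) : IsHomogeneousOfDegree 1 (of K i) := by
  classical
  refine ⟨fun l t => by simp [toWords, dynkinAction], fun w hw => ?_⟩
  rw [toWords, lift_of_apply, coeff_single, Finsupp.single_apply, if_neg]
  rintro rfl
  simp at hw

theorem toWords_ne_zero [CharZero K] (ha : IsHomogeneousOfDegree n a) (hn : 0 < n) (ha0 : a ≠ 0) :
    toWords K X a ≠ 0 := by
  intro h
  have e := ha.action 0 1
  have e' : (n : K) • a = 0 := by simpa [h, Prod.ext_iff] using e.symm
  exact (smul_ne_zero (Nat.cast_ne_zero.2 hn.ne') ha0) e'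

end IsHomogeneousOfDegree

variable (K X) in
/-- The span of the homogeneous elements of positive degree less than `N`. -/
noncomputable def spanDegreeLT (N : ℕ) : Submodule K (FreeLieAlgebra K X) :=
  Submodule.span K {a | ∃ n, 0 < n ∧ n < N ∧ IsHomogeneousOfDegree n a}

theorem spanDegreeLT_mono {N M : ℕ} (h : N ≤ M) : spanDegreeLT K X N ≤ spanDegreeLT K X M :=
  Submodule.span_mono fun _ ⟨n, h0, hn, ha⟩ => ⟨n, h0, hn.trans_le h, ha⟩

theorem lie_mem_spanDegreeLT {N M : ℕ} {a b : FreeLieAlgebra K X} (ha : a ∈ spanDegreeLT K X N)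
    (hb : b ∈ spanDegreeLT K X M) : ⁅a, b⁆ ∈ spanDegreeLT K X (N + M) := by
  induction ha, hb using Submodule.span_induction₂ with
  | mem_mem a b ha hb =>
    obtain ⟨n, hn0, hn, ha⟩ := ha
    obtain ⟨m, hm0, hm, hb⟩ := hb
    exact Submodule.subset_span ⟨n + m, by omega, by omega, ha.lie hb⟩
  | zero_left => simp
  | zero_right => simp
  | add_left a b c _ _ _ h₁ h₂ => rw [add_lie]; exact add_mem h₁ h₂
  | add_right a b c _ _ _ h₁ h₂ => rw [lie_add]; exact add_mem h₁ h₂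
  | smul_left c a b _ _ h => rw [smul_lie]; exact Submodule.smul_mem _ _ h
  | smul_right c a b _ _ h => rw [lie_smul]; exact Submodule.smul_mem _ _ h

theorem exists_mem_spanDegreeLT (a : FreeLieAlgebra K X) : ∃ N, a ∈ spanDegreeLT K X N := by
  induction a using induction with
  | zero => exact ⟨0, zero_mem _⟩
  | add a b ha hb =>
    obtain ⟨N, ha⟩ := ha
    obtain ⟨M, hb⟩ := hb
    exact ⟨max N M, add_mem (spanDegreeLT_mono (le_max_left _ _) ha)
      (spanDegreeLT_mono (le_max_right _ _) hb)⟩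
  | smul c a ha => exact ha.imp fun N h => Submodule.smul_mem _ _ h
  | lie a b ha hb =>
    obtain ⟨N, ha⟩ := ha
    obtain ⟨M, hb⟩ := hb
    exact ⟨N + M, lie_mem_spanDegreeLT ha hb⟩
  | of i => exact ⟨2, Submodule.subset_span ⟨1, by simp, by simp, .of i⟩⟩

theorem toWords_mem_of_mem_spanDegreeLT {N : ℕ} {a : FreeLieAlgebra K X}
    (ha : a ∈ spanDegreeLT K X N) : toWords K X a ∈ lengthSupported K X (Set.Iio N) := by
  induction ha using Submodule.span_induction with
  | mem a ha =>
    obtain ⟨n, -, hn, ha⟩ := ha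
    exact lengthSupported_mono (by simpa using hn) ha.words
  | zero => simp
  | add a b _ _ ha hb => rw [map_add]; exact add_mem ha hb
  | smul c a _ ha => rw [map_smul]; exact Submodule.smul_mem _ _ ha

theorem exists_sub_mem_spanDegreeLT {N : ℕ} {a : FreeLieAlgebra K X}
    (ha : a ∈ spanDegreeLT K X (N + 1)) :
    ∃ h, IsHomogeneousOfDegree N h ∧ (N = 0 → h = 0) ∧ a - h ∈ spanDegreeLT K X N := by
  induction ha using Submodule.span_induction with
  | mem a ha =>
    obtain ⟨n, hn0, hn, ha⟩ := ha
    rcases Nat.lt_succ_iff_lt_or_eq.1 hn with hlt | rfl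
    · exact ⟨0, .zero, fun _ => rfl, by
        rw [sub_zero]; exact Submodule.subset_span ⟨n, hn0, hlt, ha⟩⟩
    · exact ⟨a, ha, fun h => absurd h hn0.ne', by simp⟩
  | zero => exact ⟨0, .zero, fun _ => rfl, by simp⟩
  | add a b _ _ ha hb =>
    obtain ⟨h, h₁, h₂, h₃⟩ := ha
    obtain ⟨g, g₁, g₂, g₃⟩ := hb
    refine ⟨h + g, h₁.add g₁, fun e => by rw [h₂ e, g₂ e, add_zero], ?_⟩
    rw [add_sub_add_comm]
    exact add_mem h₃ g₃
  | smul c a _ ha =>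
    obtain ⟨h, h₁, h₂, h₃⟩ := ha
    refine ⟨c • h, h₁.smul c, fun e => by rw [h₂ e, smul_zero], ?_⟩
    rw [← smul_sub]
    exact Submodule.smul_mem _ _ h₃

/-- `h` is the nonzero homogeneous component of highest degree of `a`, and `n` is its degree. -/
structure IsLeadingComponent (n : ℕ) (h a : FreeLieAlgebra K X) : Prop where
  pos : 0 < n
  ne_zero : h ≠ 0
  homogeneous : IsHomogeneousOfDegree n h
  sub_words : toWords K X a - toWords K X h ∈ lengthSupported K X (Set.Iio n)

theorem exists_isLeadingComponent {a : FreeLieAlgebra K X} (ha0 : a ≠ 0) :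
    ∃ n h, IsLeadingComponent n h a := by
  obtain ⟨N, ha⟩ := exists_mem_spanDegreeLT a
  induction N with
  | zero => simp [spanDegreeLT, ha0] at ha
  | succ N ih =>
    obtain ⟨h, h₁, h₂, h₃⟩ := exists_sub_mem_spanDegreeLT ha
    by_cases h0 : h = 0
    · exact ih (by simpa [h0] using h₃)
    · exact ⟨N, h, Nat.pos_of_ne_zero fun e => h0 (h₂ e), h0, h₁, by
        rw [← map_sub]; exact toWords_mem_of_mem_spanDegreeLT h₃⟩

theorem IsLeadingComponent.commute {n m : ℕ} {a b h g : FreeLieAlgebra K X}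
    (ha : IsLeadingComponent n h a) (hb : IsLeadingComponent m g b) (hab : ⁅a, b⁆ = 0) :
    toWords K X h * toWords K X g = toWords K X g * toWords K X h := by
  have hh := ha.homogeneous.words
  have hg := hb.homogeneous.words
  have ha' := ha.sub_words
  have hb' := hb.sub_words
  have e : toWords K X a * toWords K X b - toWords K X b * toWords K X a = 0 := by
    rw [← toWords_lie, hab, map_zero]
  set A := toWords K X a
  set B := toWords K X b
  set H := toWords K X h
  set G := toWords K X g
  have hA : A ∈ lengthSupported K X (Set.Iic n) := by
    rw [← sub_add_cancel A H]
    exact add_mem (lengthSupported_mono Set.Iio_subset_Iic_self ha')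
      (lengthSupported_mono (by simp) hh)
  rw [← sub_eq_zero]
  refine eq_zero_of_mem_lengthSupported (S := {n + m}) (T := Set.Iio (n + m)) (by simp) ?_ ?_
  · refine sub_mem (mul_mem_lengthSupported ?_ hh hg) (mul_mem_lengthSupported ?_ hg hh)
    · rintro _ rfl _ rfl
      rfl
    · rintro _ rfl _ rfl
      exact add_comm _ _
  · have e' : H * G - G * H =
        G * (A - H) + (B - G) * A - (A - H) * G - A * (B - G) := by
      rw [← sub_eq_zero, ← e]
      noncomm_ring
    rw [e']
    refine sub_mem (sub_mem (add_mem (mul_mem_lengthSupported ?_ hg ha')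
      (mul_mem_lengthSupported ?_ hb' hA)) (mul_mem_lengthSupported ?_ ha' hg))
      (mul_mem_lengthSupported ?_ hA hb') <;>
    · simp only [Set.mem_singleton_iff, Set.mem_Iio, Set.mem_Iic]
      intros
      omega

theorem IsLeadingComponent.degree_le [CharZero K] {n m : ℕ} {a b h g : FreeLieAlgebra K X}
    (ha : IsLeadingComponent n h a) (hb : IsLeadingComponent m g b) (hab : ⁅a, b⁆ = 0) :
    m ≤ n := by
  have hcomm : Commute (toWords K X h) (toWords K X g) := ha.commute hb hab
  have hh0 := ha.homogeneous.toWords_ne_zero ha.pos ha.ne_zero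
  have hg0 := hb.homogeneous.toWords_ne_zero hb.pos hb.ne_zero
  have h₁ := pow_mem_lengthSupported ha.homogeneous.words m
  have h₂ := pow_mem_lengthSupported hb.homogeneous.words n
  rw [mul_comm n m] at h₂
  obtain ⟨c, hc⟩ := exists_smul_eq_of_commute h₁ h₂ (pow_ne_zero _ hg0) (hcomm.pow_pow m n).eq
  exact le_of_pow_eq_smul_pow ha.homogeneous.words hb.homogeneous.words hh0 ha.pos hb.pos
    (coproduct_toWords h) (coproduct_toWords g) hc

theorem exists_eq_smul_of_lie_eq_zero_s11 [CharZero K] {a b : FreeLieAlgebra K X} (hb0 : b ≠ 0)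
    (hab : ⁅a, b⁆ = 0) : ∃ c : K, a = c • b := by
  by_cases ha0 : a = 0
  · exact ⟨0, by simp [ha0]⟩
  have hba : ⁅b, a⁆ = 0 := by rw [← lie_skew, hab, neg_zero]
  obtain ⟨n, h, ha⟩ := exists_isLeadingComponent ha0
  obtain ⟨m, g, hb⟩ := exists_isLeadingComponent hb0
  obtain rfl : n = m := le_antisymm (hb.degree_le ha hba) (ha.degree_le hb hab)
  obtain ⟨c, hc⟩ := exists_smul_eq_of_commute ha.homogeneous.words hb.homogeneous.words
    (hb.homogeneous.toWords_ne_zero hb.pos hb.ne_zero) (ha.commute hb hab)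
  refine ⟨c, ?_⟩
  by_contra hne
  obtain ⟨k, f, hf⟩ := exists_isLeadingComponent (sub_ne_zero.2 hne)
  have hfb : ⁅a - c • b, b⁆ = 0 := by simp [hab]
  have hbf : ⁅b, a - c • b⁆ = 0 := by rw [← lie_skew, hfb, neg_zero]
  obtain rfl : n = k := le_antisymm (hf.degree_le hb hfb) (hb.degree_le hf hbf)
  refine hf.homogeneous.toWords_ne_zero hf.pos hf.ne_zero
    (eq_zero_of_mem_lengthSupported (T := Set.Iio n) (by simp) hf.homogeneous.words ?_)
  have e : toWords K X f = (toWords K X a - toWords K X h) -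
      c • (toWords K X b - toWords K X g) - (toWords K X (a - c • b) - toWords K X f) := by
    rw [map_sub, map_smul, hc, smul_sub]
    abel
  rw [e]
  exact sub_mem (sub_mem ha.sub_words (Submodule.smul_mem _ _ hb.sub_words)) hf.sub_words

end Embedding

end FreeLieAlgebra

/-- If `D^[m + 1]` kills `a` and `D^[n + 1]` kills `b`, then only the term `⁅D^[m] a, D^[n] b⁆` of
the Leibniz formula for `D^[m + n] ⁅a, b⁆` survives. -/
theorem LieDerivation.iterate_apply_lie_of_iterate_eq_zero {R L : Type*} [CommRing R] [LieRing L]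
    [LieAlgebra R L] (D : LieDerivation R L L) {m n : ℕ} {a b : L} (ha : D^[m + 1] a = 0)
    (hb : D^[n + 1] b = 0) :
    D^[m + n] ⁅a, b⁆ = (m + n).choose m • ⁅D^[m] a, D^[n] b⁆ := by
  have hz : ∀ {k j : ℕ} {c : L}, D^[k + 1] c = 0 → k < j → D^[j] c = 0 := by
    intro k j c hc hj
    obtain ⟨i, rfl⟩ := Nat.exists_eq_add_of_le' hj
    rw [Nat.succ_eq_add_one, Function.iterate_add_apply, hc, iterate_map_zero]
  rw [D.iterate_apply_lie, Finset.sum_eq_single (m, n)]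
  · rintro ⟨i, j⟩ hij hne
    rw [Finset.HasAntidiagonal.mem_antidiagonal] at hij
    dsimp only at hij ⊢
    rcases lt_trichotomy i m with hi | rfl | hi
    · rw [hz hb (show n < j by omega), lie_zero, smul_zero]
    · exact absurd (by rw [Nat.add_left_cancel hij]) hne
    · rw [hz ha hi, zero_lie, smul_zero]
  · intro h
    simp at h

theorem constant_monomial_top_derivatives_proportional {K : Type*} [Field K] [CharZero K]
    (δ : FreeLieAlgebra K (Fin 2) →ₗ[K] FreeLieAlgebra K (Fin 2))
    (hδ : ∀ a b, δ ⁅a, b⁆ = ⁅δ a, b⁆ + ⁅a, δ b⁆)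
    (hx : δ (FreeLieAlgebra.of K 0) = 0)
    (hy : δ (FreeLieAlgebra.of K 1) = FreeLieAlgebra.of K 0)
    (A B : FreeLieAlgebra K (Fin 2)) (hM : ⁅A, B⁆ ≠ 0) (hMc : δ ⁅A, B⁆ = 0)
    (r s : ℕ) (hr : 2 ≤ r) (hs : 2 ≤ s)
    (hA : (δ ^ r) A = 0) (hB : (δ ^ s) B = 0)
    (hA' : (δ ^ (r - 1)) A ≠ 0) (hB' : (δ ^ (s - 1)) B ≠ 0) :
    ∃ α : K, α ≠ 0 ∧ (δ ^ (r - 1)) A = α • (δ ^ (s - 1)) B := by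
  obtain ⟨m, rfl⟩ : ∃ m, r = m + 1 := ⟨r - 1, by omega⟩
  obtain ⟨n, rfl⟩ : ∃ n, s = n + 1 := ⟨s - 1, by omega⟩
  have hleibniz : ∀ a b, δ ⁅a, b⁆ = ⁅a, δ b⁆ - ⁅b, δ a⁆ := fun a b => by
    rw [hδ, ← lie_skew b (δ a)]
    abel
  let D : LieDerivation K (FreeLieAlgebra K (Fin 2)) (FreeLieAlgebra K (Fin 2)) :=
    { toLinearMap := δ
      leibniz' := hleibniz }
  have hD : ∀ k c, (δ ^ k) c = D^[k] c := fun k c => Module.End.pow_apply δ k c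
  simp only [hD, Nat.add_sub_cancel] at hA hB hA' hB' ⊢
  have hzero : D^[m + n] ⁅A, B⁆ = 0 := by
    rw [show m + n = (m + n - 1) + 1 by omega, Function.iterate_add_apply]
    exact (congrArg _ hMc).trans (iterate_map_zero D _)
  rw [D.iterate_apply_lie_of_iterate_eq_zero hA hB, ← Nat.cast_smul_eq_nsmul K] at hzero
  have hcomm := (smul_eq_zero.1 hzero).resolve_left
    (Nat.cast_ne_zero.2 (Nat.choose_pos (Nat.le_add_right m n)).ne')
  obtain ⟨α, hα⟩ := FreeLieAlgebra.exists_eq_smul_of_lie_eq_zero_s11 hB' hcomm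
  refine ⟨α, ?_, hα⟩
  rintro rfl
  exact hA' (by rw [hα, zero_smul])
end
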